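/- arXiv:2512.07349 — 4 statements merged into one kernel-verified Lean document; each statement's English description precedes it below -/
import Mathlib

section
/- Let A be a type with decidable equality. There is a bijection between the set of strict total orders on A, i.e. {r : A → A → Prop // IsStrictTotalOrder A r}, and the set of sorting functions on A. -/
/-- `s` is a section of the canonical quotient map `List A → Multiset A`. -/
def IsSection {A : Type*} (s : Multiset A → List A) : Prop :=
  ∀ m : Multiset A, (↑(s m) : Multiset A) = m

/-- A list is in the image of `s`. -/
def InImage {A : Type*} (s : Multiset A → List A) (xs : List A) : Prop :=
  ∃ m : Multiset A, s m = xs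

/-- The head-least axiom for a section. -/
def HeadLeast {A : Type*} (s : Multiset A → List A) : Prop :=
  ∀ (x y : A) (xs : List A), y ∈ x :: xs → InImage s (x :: xs) → InImage s [x, y]

/-- The tail-sort axiom for a section. -/
def TailSort {A : Type*} (s : Multiset A → List A) : Prop :=
  ∀ (x : A) (xs : List A), InImage s (x :: xs) → InImage s xs

/-- A sorting function: a section satisfying head-least and tail-sort. -/
def SortingFunction (A : Type*) : Type _ :=
  {s : Multiset A → List A // IsSection s ∧ HeadLeast s ∧ TailSort s}

/-- The derived relation `≤ₛ` of a section `s`. -/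
def DerivedRel {A : Type*} (s : Multiset A → List A) (x y : A) : Prop :=
  (s {x, y}).head? = some x

namespace InImage

variable {A : Type*} {s : Multiset A → List A}

/-- A section fixes the lists in its image. -/
theorem apply_coe (hs : IsSection s) {l : List A} (h : InImage s l) : s (l : Multiset A) = l := by
  obtain ⟨m, rfl⟩ := h
  rw [hs m]

theorem pair_total (hs : IsSection s) (x y : A) : InImage s [x, y] ∨ InImage s [y, x] := by
  rcases List.perm_pair.1 (Multiset.coe_eq_coe.1 (hs ↑[x, y])) with h | h
  · exact .inl ⟨_, h⟩
  · exact .inr ⟨_, h⟩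

theorem pair_antisymm (hs : IsSection s) {x y : A} (hxy : InImage s [x, y])
    (hyx : InImage s [y, x]) : x = y := by
  have h : (↑[x, y] : Multiset A) = ↑[y, x] := Multiset.coe_eq_coe.2 (List.Perm.swap _ _ _)
  have h' := hxy.apply_coe hs
  rw [h, hyx.apply_coe hs] at h'
  exact (List.cons.inj h').1.symm

theorem pair_trans (hs : IsSection s) (hh : HeadLeast s) {x y z : A} (hxy : InImage s [x, y])
    (hyz : InImage s [y, z]) : InImage s [x, z] := by
  have hp : (s ↑[x, y, z]).Perm [x, y, z] := Multiset.coe_eq_coe.1 (hs _)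
  cases hl : s ↑[x, y, z] with
  | nil => simp [hl] at hp
  | cons a l =>
    rw [hl] at hp
    have least : ∀ b ∈ [x, y, z], InImage s [a, b] := fun b hb =>
      hh a b l (hp.mem_iff.2 hb) ⟨_, hl⟩
    have ha : a ∈ [x, y, z] := hp.mem_iff.1 List.mem_cons_self
    simp only [List.mem_cons, List.not_mem_nil, or_false] at ha
    rcases ha with rfl | rfl | rfl
    · exact least z (by simp)
    · rwa [pair_antisymm hs hxy (least x (by simp))]
    · rwa [← pair_antisymm hs hyz (least y (by simp))]

theorem pairwise (hh : HeadLeast s) (ht : TailSort s) {l : List A} (h : InImage s l) :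
    l.Pairwise fun x y => InImage s [x, y] := by
  induction l with
  | nil => exact .nil
  | cons x xs ih =>
    exact .cons (fun y hy => hh x y xs (List.mem_cons_of_mem x hy) h) (ih (ht x xs h))

end InImage

theorem SortingFunction.isStrictTotalOrder {A : Type*} (s : SortingFunction A) :
    IsStrictTotalOrder A fun x y => x ≠ y ∧ InImage s.1 [x, y] where
  irrefl x h := h.1 rfl
  trans x y z hxy hyz := by
    refine ⟨?_, hxy.2.pair_trans s.2.1 s.2.2.1 hyz.2⟩
    rintro rfl
    exact hxy.1 (hxy.2.pair_antisymm s.2.1 hyz.2)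
  trichotomous x y hxy hyx := by
    by_contra hne
    rcases InImage.pair_total s.2.1 x y with h | h
    · exact hxy ⟨hne, h⟩
    · exact hyx ⟨Ne.symm hne, h⟩

section StrictTotalOrder

variable {A : Type*} (r : A → A → Prop) [IsStrictTotalOrder A r]

theorem pairwise_perm_unique {l₁ l₂ : List A} (h₁ : l₁.Pairwise fun x y => r x y ∨ x = y)
    (h₂ : l₂.Pairwise fun x y => r x y ∨ x = y) (h : l₁.Perm l₂) : l₁ = l₂ := by
  refine h.eq_of_pairwise (fun a b _ _ hab hba => ?_) h₁ h₂
  rcases hab with hab | hab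
  · rcases hba with hba | hba
    · exact (asymm_of r hab hba).elim
    · exact hba.symm
  · exact hab

open Classical in
/-- Sort a multiset with respect to a strict total order. -/
noncomputable def strictSort (m : Multiset A) : List A :=
  letI := linearOrderOfSTO r
  m.sort

theorem coe_strictSort (m : Multiset A) : (strictSort r m : Multiset A) = m :=
  letI := Classical.decRel r
  letI := linearOrderOfSTO r
  m.sort_eq _

theorem pairwise_strictSort (m : Multiset A) :
    (strictSort r m).Pairwise fun x y => r x y ∨ x = y := by
  classical
  let := linearOrderOfSTO r
  exact (m.pairwise_sort (· ≤ ·)).imp fun h => h.lt_or_eq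

theorem inImage_strictSort_iff {l : List A} :
    InImage (strictSort r) l ↔ l.Pairwise fun x y => r x y ∨ x = y := by
  constructor
  · rintro ⟨m, rfl⟩
    exact pairwise_strictSort r m
  · exact fun h => ⟨l, pairwise_perm_unique r (pairwise_strictSort r l) h
      (Multiset.coe_eq_coe.1 (coe_strictSort r l))⟩

/-- The sorting function of a strict total order. -/
noncomputable def SortingFunction.ofStrictTotalOrder : SortingFunction A where
  val := strictSort r
  property := by
    refine ⟨coe_strictSort r, fun x y xs hy h => ?_, fun x xs h => ?_⟩
    · rw [inImage_strictSort_iff] at h ⊢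
      rcases List.mem_cons.1 hy with rfl | hy
      · simp
      · simpa using List.rel_of_pairwise_cons h hy
    · rw [inImage_strictSort_iff] at h ⊢
      exact h.of_cons

end StrictTotalOrder

theorem sorting_functions_equiv_strict_total_orders (A : Type*) [DecidableEq A] :
    Nonempty ({r : A → A → Prop // IsStrictTotalOrder A r} ≃ SortingFunction A) := by
  refine ⟨{
    toFun := fun r => @SortingFunction.ofStrictTotalOrder A r.1 r.2
    invFun := fun s => ⟨_, s.isStrictTotalOrder⟩
    left_inv := ?_
    right_inv := ?_ }⟩
  · rintro ⟨r, hr⟩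
    ext x y
    change x ≠ y ∧ InImage (strictSort r) [x, y] ↔ r x y
    rw [inImage_strictSort_iff]
    simp only [List.pairwise_pair]
    refine ⟨fun h => h.2.resolve_right h.1, fun h => ⟨?_, .inl h⟩⟩
    exact ne_of_irrefl h
  · intro s
    have := s.isStrictTotalOrder
    refine Subtype.ext (funext fun m => ?_)
    refine pairwise_perm_unique (fun x y => x ≠ y ∧ InImage s.1 [x, y])
      (pairwise_strictSort _ m) ?_
      (Multiset.coe_eq_coe.1 ((coe_strictSort _ m).trans (s.2.1 m).symm))
    refine (InImage.pairwise s.2.2.1 s.2.2.2 ⟨m, rfl⟩).imp fun {x y} h => ?_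
    by_cases hxy : x = y
    · exact .inr hxy
    · exact .inl ⟨hxy, h⟩
end

section
/- Let A be a type with decidable equality. There is a bijection between the set of total meet semilattice structures on A and the set of sorting functions on A. -/
/-- A total meet semilattice structure on `A`. -/
def IsTotalMeetSemilattice {A : Type*} (m : A → A → A) : Prop :=
  (∀ x, m x x = x) ∧ (∀ x y z, m (m x y) z = m x (m y z)) ∧
  (∀ x y, m x y = m y x) ∧ (∀ x y, m x y = x ∨ m x y = y)

namespace IsTotalMeetSemilattice

variable {A : Type*} {m : A → A → A}

/-- The relation `m x y = x` attached to a meet operation `m`. -/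
def Rel (m : A → A → A) (x y : A) : Prop := m x y = x

instance [DecidableEq A] : DecidableRel (Rel m) := fun x y => inferInstanceAs (Decidable (m x y = x))

theorem isTrans (h : IsTotalMeetSemilattice m) : IsTrans A (Rel m) where
  trans x y z hxy hyz := by
    unfold Rel at *
    rw [← hxy, h.2.1, hyz]

theorem antisymm (h : IsTotalMeetSemilattice m) : Std.Antisymm (Rel m) where
  antisymm x y hxy hyx := by
    unfold Rel at *
    rw [← hxy, h.2.2.1, hyx]

theorem total (h : IsTotalMeetSemilattice m) : Std.Total (Rel m) where
  total x y := by
    unfold Rel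
    rw [h.2.2.1 y x]
    exact h.2.2.2 x y

/-- The sorting function attached to a total meet semilattice. -/
def sort [DecidableEq A] (h : IsTotalMeetSemilattice m) (s : Multiset A) : List A :=
  haveI := h.isTrans
  haveI := h.antisymm
  haveI := h.total
  s.sort (Rel m)

theorem coe_sort [DecidableEq A] (h : IsTotalMeetSemilattice m) (s : Multiset A) :
    (h.sort s : Multiset A) = s :=
  haveI := h.isTrans
  haveI := h.antisymm
  haveI := h.total
  Multiset.sort_eq _ _

theorem pairwise_sort [DecidableEq A] (h : IsTotalMeetSemilattice m) (s : Multiset A) :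
    (h.sort s).Pairwise (Rel m) :=
  haveI := h.isTrans
  haveI := h.antisymm
  haveI := h.total
  Multiset.pairwise_sort _ _

theorem sort_coe_eq [DecidableEq A] (h : IsTotalMeetSemilattice m) {l : List A}
    (hl : l.Pairwise (Rel m)) : h.sort l = l :=
  haveI := h.antisymm
  (Multiset.coe_eq_coe.1 (h.coe_sort l)).eq_of_pairwise' (h.pairwise_sort l) hl

theorem inImage_sort_iff [DecidableEq A] (h : IsTotalMeetSemilattice m) {l : List A} :
    InImage h.sort l ↔ l.Pairwise (Rel m) :=
  ⟨fun ⟨s, hs⟩ => hs ▸ h.pairwise_sort s, fun hl => ⟨l, h.sort_coe_eq hl⟩⟩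

theorem headLeast_sort [DecidableEq A] (h : IsTotalMeetSemilattice m) : HeadLeast h.sort := by
  intro x y xs hy hxs
  rw [inImage_sort_iff] at hxs ⊢
  rw [List.pairwise_pair]
  rcases List.mem_cons.1 hy with rfl | hy
  · exact h.1 y
  · exact List.rel_of_pairwise_cons hxs hy

theorem tailSort_sort [DecidableEq A] (h : IsTotalMeetSemilattice m) : TailSort h.sort := by
  intro x xs hxs
  rw [inImage_sort_iff] at hxs ⊢
  exact hxs.of_cons

end IsTotalMeetSemilattice

section SortingFunction

variable {A : Type*} {s : Multiset A → List A}

theorem IsSection.inImage_iff (hs : IsSection s) {l : List A} : InImage s l ↔ s l = l := by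
  refine ⟨?_, fun h => ⟨l, h⟩⟩
  rintro ⟨m, rfl⟩
  rw [hs m]

theorem IsSection.inImage_pair_total (hs : IsSection s) (x y : A) :
    InImage s [x, y] ∨ InImage s [y, x] := by
  have h : (s ↑[x, y]).Perm [x, y] := Multiset.coe_eq_coe.1 (hs _)
  rcases List.perm_pair.1 h with h | h
  · exact .inl ⟨_, h⟩
  · exact .inr ⟨_, h⟩

theorem IsSection.inImage_pair_antisymm (hs : IsSection s) {x y : A}
    (hxy : InImage s [x, y]) (hyx : InImage s [y, x]) : x = y := by
  rw [hs.inImage_iff] at hxy hyx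
  have h : (↑[x, y] : Multiset A) = ↑[y, x] := Multiset.coe_eq_coe.2 (.swap _ _ _)
  rw [h, hyx] at hxy
  exact (List.cons.inj hxy).1.symm

theorem IsSection.inImage_pair_trans (hs : IsSection s) (hh : HeadLeast s) {x y z : A}
    (hxy : InImage s [x, y]) (hyz : InImage s [y, z]) : InImage s [x, z] := by
  have hp : (s ↑[x, y, z]).Perm [x, y, z] := Multiset.coe_eq_coe.1 (hs _)
  obtain ⟨a, l, hl⟩ := List.exists_cons_of_ne_nil (l := s ↑[x, y, z]) (by
    intro h
    simp [h] at hp)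
  rw [hl] at hp
  have least : ∀ b ∈ [x, y, z], InImage s [a, b] := fun b hb =>
    hh a b l (hp.mem_iff.2 hb) ⟨_, hl⟩
  have ha : a ∈ [x, y, z] := hp.mem_iff.1 (by simp)
  simp only [List.mem_cons, List.not_mem_nil, or_false] at ha
  rcases ha with rfl | rfl | rfl
  · exact least z (by simp)
  · rwa [hs.inImage_pair_antisymm hxy (least x (by simp))]
  · rwa [← hs.inImage_pair_antisymm hyz (least y (by simp))]

theorem pairwise_of_inImage (hh : HeadLeast s) (ht : TailSort s) {l : List A}
    (hl : InImage s l) : l.Pairwise fun x y => InImage s [x, y] := by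
  induction l with
  | nil => exact .nil
  | cons x xs ih =>
    exact .cons (fun y hy => hh x y xs (List.mem_cons_of_mem x hy) hl) (ih (ht x xs hl))

open Classical in
/-- The meet operation attached to a section: the first entry of `s {x, y}`. -/
noncomputable def sectionMeet (s : Multiset A → List A) (x y : A) : A :=
  if InImage s [x, y] then x else y

theorem IsSection.sectionMeet_eq_left_iff (hs : IsSection s) {x y : A} :
    sectionMeet s x y = x ↔ InImage s [x, y] := by
  unfold sectionMeet
  split_ifs with h
  · simp [h]
  · refine ⟨?_, fun h' => absurd h' h⟩
    rintro rfl
    exact (hs.inImage_pair_total y y).elim id id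

theorem IsSection.isTotalMeetSemilattice_sectionMeet (hs : IsSection s) (hh : HeadLeast s) :
    IsTotalMeetSemilattice (sectionMeet s) := by
  have total := hs.inImage_pair_total
  have antisymm := fun x y => hs.inImage_pair_antisymm (x := x) (y := y)
  have trans := fun x y z => hs.inImage_pair_trans hh (x := x) (y := y) (z := z)
  unfold sectionMeet
  refine ⟨fun x => ite_self x, fun x y z => ?_, fun x y => ?_, fun x y => ?_⟩ <;> grind

end SortingFunction

theorem sorting_functions_equiv_total_meet_semilattices (A : Type*) [DecidableEq A] :
    Nonempty ({m : A → A → A // IsTotalMeetSemilattice m} ≃ SortingFunction A) := by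
  let f : {m : A → A → A // IsTotalMeetSemilattice m} → SortingFunction A := fun m =>
    ⟨m.2.sort, m.2.coe_sort, m.2.headLeast_sort, m.2.tailSort_sort⟩
  refine ⟨Equiv.ofBijective f ⟨?_, ?_⟩⟩
  · rintro ⟨m, hm⟩ ⟨m', hm'⟩ h
    have hsort : hm.sort = hm'.sort := congrArg Subtype.val h
    have key : ∀ x y, m x y = x ↔ m' x y = x := fun x y => by
      have hx := hm.inImage_sort_iff (l := [x, y])
      rw [hsort, hm'.inImage_sort_iff, List.pairwise_pair, List.pairwise_pair] at hx
      exact hx.symm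
    refine Subtype.ext (funext₂ fun x y => ?_)
    have h₁ := hm.2.2.2 x y
    have h₂ := hm'.2.2.2 x y
    have h₃ := key x y
    grind
  · rintro ⟨s, hs, hh, ht⟩
    have hm := hs.isTotalMeetSemilattice_sectionMeet hh
    refine ⟨⟨sectionMeet s, hm⟩, Subtype.ext (funext fun t => ?_)⟩
    have hp : (s t).Pairwise (IsTotalMeetSemilattice.Rel (sectionMeet s)) :=
      (pairwise_of_inImage hh ht ⟨t, rfl⟩).imp hs.sectionMeet_eq_left_iff.2
    have := hm.sort_coe_eq hp
    rwa [hs t] at this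
end

section
/- Let A be a type and s : Multiset A → List A a section of the canonical quotient map. Then the derived relation ≤ₛ is reflexive (x ≤ₛ x for all x), antisymmetric (x ≤ₛ y and y ≤ₛ x imply x = y), and total (for all x y, x ≤ₛ y or y ≤ₛ x). -/
/-- The value of a section on a two-element multiset is one of its two orderings. -/
theorem IsSection.pair_eq_or {A : Type*} {s : Multiset A → List A} (hs : IsSection s) (x y : A) :
    s {x, y} = [x, y] ∨ s {x, y} = [y, x] :=
  List.perm_pair.mp (Multiset.coe_eq_coe.mp (hs {x, y}))

theorem derivedRel_refl_antisymm_total {A : Type*} (s : Multiset A → List A)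
    (hs : IsSection s) :
    (∀ x : A, DerivedRel s x x) ∧
    (∀ x y : A, DerivedRel s x y → DerivedRel s y x → x = y) ∧
    (∀ x y : A, DerivedRel s x y ∨ DerivedRel s y x) := by
  have total : ∀ x y : A, DerivedRel s x y ∨ DerivedRel s y x := fun x y => by
    unfold DerivedRel
    rw [Multiset.pair_comm y x]
    rcases hs.pair_eq_or x y with h | h <;> rw [h] <;> simp
  refine ⟨fun x => or_self_iff.mp (total x x), fun x y hxy hyx => ?_, total⟩
  unfold DerivedRel at hxy hyx
  rw [Multiset.pair_comm y x] at hyx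
  exact Option.some.inj (hxy.symm.trans hyx)
end

section
/- Let A be a type and s : Multiset A → List A a section of the canonical quotient map satisfying head-least. Then the derived relation ≤ₛ is transitive: for all x y z : A, if x ≤ₛ y and y ≤ₛ z then x ≤ₛ z. -/
theorem IsSection.derivedRel_of_inImage {A : Type*} {s : Multiset A → List A}
    (hs : IsSection s) {x y : A} (h : InImage s [x, y]) : DerivedRel s x y := by
  obtain ⟨m, hm⟩ := h
  have hxy : m = {x, y} := by
    rw [← hs m, hm]
    rfl
  simp [DerivedRel, ← hxy, hm]

theorem DerivedRel.antisymm {A : Type*} {s : Multiset A → List A} {x y : A}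
    (hxy : DerivedRel s x y) (hyx : DerivedRel s y x) : x = y := by
  unfold DerivedRel at hxy hyx
  rw [Multiset.pair_comm, hxy] at hyx
  exact Option.some.inj hyx

/-- A nonempty multiset contains an element related to all of its elements. -/
theorem HeadLeast.exists_mem_forall_derivedRel {A : Type*} {s : Multiset A → List A}
    (hhl : HeadLeast s) (hs : IsSection s) {m : Multiset A} (hm : m ≠ 0) :
    ∃ u ∈ m, ∀ y ∈ m, DerivedRel s u y := by
  have mem_iff (y : A) : y ∈ s m ↔ y ∈ m := by
    rw [← Multiset.mem_coe, hs m]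
  cases h : s m with
  | nil =>
    refine absurd ?_ hm
    rw [← hs m, h, Multiset.coe_nil]
  | cons u us =>
    rw [h] at mem_iff
    exact ⟨u, (mem_iff u).1 List.mem_cons_self, fun y hy =>
      hs.derivedRel_of_inImage (hhl u y us ((mem_iff y).2 hy) ⟨m, h⟩)⟩

theorem derivedRel_trans_of_headLeast {A : Type*} (s : Multiset A → List A)
    (hs : IsSection s) (hhl : HeadLeast s) :
    ∀ x y z : A, DerivedRel s x y → DerivedRel s y z → DerivedRel s x z := by
  intro x y z hxy hyz
  obtain ⟨u, hu, hle⟩ :=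
    hhl.exists_mem_forall_derivedRel hs (m := {x, y, z}) Multiset.cons_ne_zero
  have hx := hle x (by simp)
  have hy := hle y (by simp)
  have hz := hle z (by simp)
  have hu' : u = x ∨ u = y ∨ u = z := by simpa using hu
  rcases hu' with rfl | rfl | rfl
  · exact hz
  · rwa [hxy.antisymm hx]
  · rwa [← hyz.antisymm hy]
end
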